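/- Let λ ∈ ℝ with λ ≠ 0 and λ ≠ −1, and let Y be a strictly positive random variable with E(Y) < ∞ and E(Y^{λ+1}) < ∞. Then the function δ ↦ E[L_{PDL,λ}(δ, Y)] on (0, ∞) attains its minimum at the unique point δ* = (E(Y^{λ+1}))^{1/(λ+1)}. -/

import Mathlib

open MeasureTheory

/-- The power-divergence loss with power parameter `lam`, defined for `δ > 0`, `Y > 0`. -/
noncomputable def PDL (lam δ Y : ℝ) : ℝ :=
  if lam = 0 then Y * Real.log (Y / δ) - (Y - δ)
  else if lam = -1 then Y - δ - δ * Real.log (Y / δ)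
  else (1 / (lam * (lam + 1))) * (Y * ((Y / δ) ^ lam - 1) + lam * (δ - Y))

/-- Bernoulli's inequality for negative exponents, strict form. -/
theorem one_add_mul_sub_one_lt_rpow_of_neg {t p : ℝ} (ht : 0 < t) (ht1 : t ≠ 1) (hp : p < 0) :
    1 + p * (t - 1) < t ^ p := by
  have hinv : 0 < t⁻¹ := inv_pos.2 ht
  have h := one_add_mul_self_lt_rpow_one_add (s := t⁻¹ - 1) (by linarith)
    (sub_ne_zero.2 (by simpa using ht1)) (p := 1 - p) (by linarith)
  rw [add_sub_cancel, Real.inv_rpow ht.le, ← Real.rpow_neg ht.le, neg_sub,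
    Real.rpow_sub_one ht.ne'] at h
  have h' := mul_lt_mul_of_pos_left h ht
  rw [mul_div_cancel₀ _ ht.ne'] at h'
  have e : t * (1 + (1 - p) * (t⁻¹ - 1)) = 1 + p * (t - 1) := by
    field_simp
    ring
  rwa [e] at h'

/-- Bernoulli's inequality, normalised so that it is uniform in the exponent. -/
theorem rpow_sub_one_sub_mul_div_pos {t p : ℝ} (ht : 0 < t) (ht1 : t ≠ 1) (hp0 : p ≠ 0)
    (hp1 : p ≠ 1) : 0 < (t ^ p - 1 - p * (t - 1)) / ((p - 1) * p) := by
  have hs : t - 1 ≠ 0 := sub_ne_zero.2 ht1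
  rcases hp0.lt_or_gt with hp | hp
  · have h := one_add_mul_sub_one_lt_rpow_of_neg ht ht1 hp
    exact div_pos (by linarith) (mul_pos_of_neg_of_neg (by linarith) hp)
  rcases hp1.lt_or_gt with hp' | hp'
  · have h := rpow_one_add_lt_one_add_mul_self (s := t - 1) (by linarith) hs hp hp'
    rw [add_sub_cancel] at h
    exact div_pos_of_neg_of_neg (by linarith) (mul_neg_of_neg_of_pos (by linarith) hp)
  · have h := one_add_mul_self_lt_rpow_one_add (s := t - 1) (by linarith) hs hp'
    rw [add_sub_cancel] at h
    exact div_pos (by linarith) (mul_pos (by linarith) hp)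

theorem PDL_eq {lam δ Y : ℝ} (hlam0 : lam ≠ 0) (hlam1 : lam ≠ -1) (hδ : 0 < δ) (hY : 0 < Y) :
    PDL lam δ Y =
      1 / (lam * (lam + 1)) * (δ ^ (-lam) * Y ^ (lam + 1) - (lam + 1) * Y + lam * δ) := by
  rw [PDL, if_neg hlam0, if_neg hlam1, Real.div_rpow hY.le hδ.le, Real.rpow_neg hδ.le,
    Real.rpow_add_one hY.ne']
  ring

theorem integral_PDL {Ω : Type*} [MeasurableSpace Ω] {μ : Measure Ω} [IsProbabilityMeasure μ]
    {lam δ : ℝ} (hlam0 : lam ≠ 0) (hlam1 : lam ≠ -1) (hδ : 0 < δ)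
    {Y : Ω → ℝ} (hYpos : ∀ ω, 0 < Y ω) (hYint : Integrable Y μ)
    (hYpow : Integrable (fun ω => Y ω ^ (lam + 1)) μ) :
    ∫ ω, PDL lam δ (Y ω) ∂μ = 1 / (lam * (lam + 1)) *
      (δ ^ (-lam) * (∫ ω, Y ω ^ (lam + 1) ∂μ) - (lam + 1) * (∫ ω, Y ω ∂μ) + lam * δ) := by
  have hsub : Integrable (fun ω => δ ^ (-lam) * Y ω ^ (lam + 1) - (lam + 1) * Y ω) μ :=
    (hYpow.const_mul _).sub (hYint.const_mul _)
  simp_rw [fun ω => PDL_eq hlam0 hlam1 hδ (hYpos ω)]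
  rw [integral_const_mul, integral_add hsub (integrable_const _),
    integral_sub (hYpow.const_mul _) (hYint.const_mul _),
    integral_const_mul, integral_const_mul]
  simp

/-- Let `λ ≠ 0, −1` and let `Y` be a strictly positive random variable with `E(Y) < ∞`
and `E(Y^{λ+1}) < ∞`. Then `δ ↦ E[L_{PDL,λ}(δ, Y)]` on `(0, ∞)` attains its minimum at
the unique point `δ* = (E(Y^{λ+1}))^{1/(λ+1)}`. -/
theorem expected_PDL_min {Ω : Type*} [MeasureSpace Ω]
    [IsProbabilityMeasure (volume : Measure Ω)]
    (lam : ℝ) (hlam0 : lam ≠ 0) (hlam1 : lam ≠ -1)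
    (Y : Ω → ℝ) (hYmeas : Measurable Y) (hYpos : ∀ ω, 0 < Y ω)
    (hYint : Integrable Y) (hYpow : Integrable (fun ω => Y ω ^ (lam + 1))) :
    0 < (∫ ω, Y ω ^ (lam + 1)) ^ (1 / (lam + 1)) ∧
    IsMinOn (fun δ => ∫ ω, PDL lam δ (Y ω)) (Set.Ioi (0 : ℝ))
      ((∫ ω, Y ω ^ (lam + 1)) ^ (1 / (lam + 1))) ∧
    ∀ δ ∈ Set.Ioi (0 : ℝ), δ ≠ (∫ ω, Y ω ^ (lam + 1)) ^ (1 / (lam + 1)) →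
      (∫ ω, PDL lam ((∫ ω', Y ω' ^ (lam + 1)) ^ (1 / (lam + 1))) (Y ω)) <
        ∫ ω, PDL lam δ (Y ω) := by
  have hp : lam + 1 ≠ 0 := fun h => hlam1 (by linarith)
  have hM : 0 < ∫ ω, Y ω ^ (lam + 1) := by
    have hpos : ∀ ω, 0 < Y ω ^ (lam + 1) := fun ω => Real.rpow_pos_of_pos (hYpos ω) _
    rw [integral_pos_iff_support_of_nonneg (fun ω => (hpos ω).le) hYpow,
      Set.eq_univ_of_forall (s := Function.support _) fun ω => (hpos ω).ne']
    simp
  have hD : 0 < (∫ ω, Y ω ^ (lam + 1)) ^ (1 / (lam + 1)) := Real.rpow_pos_of_pos hM _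
  have hDM : ((∫ ω, Y ω ^ (lam + 1)) ^ (1 / (lam + 1))) ^ (lam + 1) = ∫ ω, Y ω ^ (lam + 1) := by
    rw [← Real.rpow_mul hM.le, one_div_mul_cancel hp, Real.rpow_one]
  have hlt : ∀ δ ∈ Set.Ioi (0 : ℝ), δ ≠ (∫ ω, Y ω ^ (lam + 1)) ^ (1 / (lam + 1)) →
      (∫ ω, PDL lam ((∫ ω', Y ω' ^ (lam + 1)) ^ (1 / (lam + 1))) (Y ω)) <
        ∫ ω, PDL lam δ (Y ω) := by
    intro δ hδ hne
    rw [Set.mem_Ioi] at hδ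
    rw [integral_PDL hlam0 hlam1 hD hYpos hYint hYpow,
      integral_PDL hlam0 hlam1 hδ hYpos hYint hYpow]
    generalize (∫ ω, Y ω ^ (lam + 1)) ^ (1 / (lam + 1)) = D at *
    rw [← hDM]
    have h := mul_pos hδ (rpow_sub_one_sub_mul_div_pos (div_pos hD hδ)
      (fun h => hne ((div_eq_one_iff_eq hδ.ne').1 h).symm) hp (by simpa using hlam0))
    rw [Real.div_rpow hD.le hδ.le, add_sub_cancel_right, Real.rpow_add_one hδ.ne'] at h
    have hDD : D ^ (-lam) * D ^ (lam + 1) = D := by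
      rw [← Real.rpow_add hD, neg_add_cancel_left, Real.rpow_one]
    rw [← sub_pos, hDD, Real.rpow_neg hδ.le]
    have hδl := (Real.rpow_pos_of_pos hδ lam).ne'
    refine h.trans_eq ?_
    field_simp
    ring
  refine ⟨hD, isMinOn_iff.2 fun δ hδ => ?_, hlt⟩
  rcases eq_or_ne δ ((∫ ω, Y ω ^ (lam + 1)) ^ (1 / (lam + 1))) with heq | hne
  · rw [heq]
  · exact (hlt δ hδ hne).le
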